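/- arXiv:1705.04216 — 2 statements merged into one kernel-verified Lean document; each statement's English description precedes it below -/
import Mathlib

section
/- Let p > 1 and ω ∈ (−1,1), and let φ_ω be the explicit ground state. Then E(Φ_ω) = ((p−1+4ω²)/(p+3))·∫_ℝ φ_ω² dx, where E(Φ_ω) = (1/2)(ω²∫φ_ω² + ∫(φ_ω')² + ∫φ_ω²) − (1/(p+1))∫φ_ω^{p+1}. Moreover, if 1 < p < 5 and |ω| = ω_c = √(p−1)/2, then (p+3)·E(Φ_ω) + 8ω·Q(Φ_ω) = 0, where Q(Φ_ω) = −ω∫_ℝ φ_ω² dx. -/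
open MeasureTheory ComplexConjugate

/-- The explicit one-dimensional ground state of `-φ'' + (1-ω²)φ = φ^p`. -/
noncomputable def groundState (p ω : ℝ) (x : ℝ) : ℝ :=
  ((p + 1) * (1 - ω ^ 2) / 2) ^ ((1 : ℝ) / (p - 1)) *
    Real.cosh ((p - 1) / 2 * Real.sqrt (1 - ω ^ 2) * x) ^ (-(2 : ℝ) / (p - 1))

/-- `∫ φ_ω²`. -/
noncomputable def Nphi (p ω : ℝ) : ℝ := ∫ x : ℝ, groundState p ω x ^ 2

/-- `∫ (φ_ω')²`. -/
noncomputable def Kphi (p ω : ℝ) : ℝ := ∫ x : ℝ, deriv (groundState p ω) x ^ 2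

/-- `∫ φ_ω^{p+1}`. -/
noncomputable def PPphi (p ω : ℝ) : ℝ := ∫ x : ℝ, groundState p ω x ^ (p + 1)

/-- The energy of the standing wave pair `Φ_ω = (φ_ω, iωφ_ω)`:
`E(Φ_ω) = (1/2)(ω²∫φ_ω² + ∫(φ_ω')² + ∫φ_ω²) − (1/(p+1))∫φ_ω^{p+1}`. -/
noncomputable def energyPhi (p ω : ℝ) : ℝ :=
  (1 / 2) * (ω ^ 2 * Nphi p ω + Kphi p ω + Nphi p ω) - (1 / (p + 1)) * PPphi p ω

/-- The charge of the standing wave, `Q(Φ_ω) = -ω ∫ φ_ω²`. -/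
noncomputable def chargePhi (p ω : ℝ) : ℝ := -ω * Nphi p ω

lemma aux_integrable (a r : ℝ) (ha : 0 < a) (hr : 0 < r) :
    Integrable (fun x : ℝ => Real.cosh (a * x) ^ (-r)) := by
  have hc : Continuous (fun x : ℝ => Real.cosh (a * x) ^ (-r)) :=
    (Real.continuous_cosh.comp (continuous_const.mul continuous_id)).rpow_const
      (fun x => Or.inl (Real.cosh_pos _).ne')
  refine hc.locallyIntegrable.integrable_of_isBigO_atTop_of_norm_isNegInvariant
    (g := fun x : ℝ => Real.exp (-(a * r) * x)) ?_ ?_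
    ⟨Set.Ioi 0, Filter.Ioi_mem_atTop 0, exp_neg_integrableOn_Ioi 0 (by positivity)⟩
  · refine Filter.Eventually.of_forall fun x => ?_
    simp [mul_neg, Real.cosh_neg]
  · refine Asymptotics.IsBigO.of_bound ((2 : ℝ) ^ r) (Filter.Eventually.of_forall fun x => ?_)
    have h1 : Real.exp (a * x) / 2 ≤ Real.cosh (a * x) := by
      rw [Real.cosh_eq]
      have := Real.exp_pos (-(a * x))
      linarith
    have h2 := Real.rpow_le_rpow_of_nonpos (by positivity) h1 (by linarith : -r ≤ 0)
    have hpos : 0 < Real.cosh (a * x) := Real.cosh_pos _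
    rw [Real.norm_of_nonneg (by positivity), Real.norm_of_nonneg (by positivity)]
    refine h2.trans (le_of_eq ?_)
    rw [Real.div_rpow (by positivity) (by positivity), ← Real.exp_mul, Real.rpow_neg (by positivity)]
    rw [div_inv_eq_mul, mul_comm]
    congr 2
    ring

lemma aux_deriv (a r : ℝ) (x : ℝ) :
    HasDerivAt (fun x : ℝ => Real.cosh (a * x) ^ r)
      (a * r * Real.sinh (a * x) * Real.cosh (a * x) ^ (r - 1)) x := by
  have h : HasDerivAt (fun x : ℝ => a * x) a x := by simpa using (hasDerivAt_id x).const_mul a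
  have h2 := h.cosh.rpow_const (p := r) (Or.inl (Real.cosh_pos _).ne')
  refine h2.congr_deriv ?_
  ring

lemma aux_J (a t : ℝ) (ha : 0 < a) (ht : 0 < t) :
    (t + 1) * ∫ x : ℝ, Real.cosh (a * x) ^ (-(t + 2)) =
      t * ∫ x : ℝ, Real.cosh (a * x) ^ (-t) := by
  have hI := aux_integrable a t ha ht
  have hJ := aux_integrable a (t + 2) ha (by linarith)
  have hd : ∀ x : ℝ, HasDerivAt (fun x => Real.sinh (a * x) * Real.cosh (a * x) ^ (-t - 1))
      (a * ((t + 1) * Real.cosh (a * x) ^ (-(t + 2)) - t * Real.cosh (a * x) ^ (-t))) x := by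
    intro x
    have h : HasDerivAt (fun x : ℝ => a * x) a x := by simpa using (hasDerivAt_id x).const_mul a
    refine (h.sinh.mul (aux_deriv a (-t - 1) x)).congr_deriv ?_
    have hpos : 0 < Real.cosh (a * x) := Real.cosh_pos _
    have e1 : Real.cosh (a * x) ^ (-t - 1) =
        Real.cosh (a * x) ^ (-(t + 2)) * Real.cosh (a * x) := by
      rw [← Real.rpow_add_one hpos.ne']; congr 1; ring
    have e2 : Real.cosh (a * x) ^ (-t) =
        Real.cosh (a * x) ^ (-(t + 2)) * Real.cosh (a * x) ^ 2 := by
      rw [← Real.rpow_natCast, ← Real.rpow_add hpos]; congr 1; push_cast; ring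
    have e3 : (-t - 1 - 1) = -(t + 2) := by ring
    rw [e3, e1, e2]
    have := Real.cosh_sq (a * x)
    linear_combination (a * (t + 1) * Real.cosh (a * x) ^ (-(t + 2))) * this
  have hf : Integrable (fun x => Real.sinh (a * x) * Real.cosh (a * x) ^ (-t - 1)) := by
    refine hI.mono (continuous_iff_continuousAt.2
      fun x => (hd x).continuousAt).aestronglyMeasurable
      (Filter.Eventually.of_forall fun x => ?_)
    have hpos : 0 < Real.cosh (a * x) := Real.cosh_pos _
    have e1 : Real.cosh (a * x) ^ (-t) =
        Real.cosh (a * x) * Real.cosh (a * x) ^ (-t - 1) := by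
      rw [mul_comm (Real.cosh (a * x)), ← Real.rpow_add_one hpos.ne']; congr 1; ring
    rw [e1, norm_mul, norm_mul]
    gcongr
    rw [Real.norm_eq_abs, Real.norm_eq_abs, ← sq_le_sq, Real.cosh_sq]
    linarith
  have h0 := integral_eq_zero_of_hasDerivAt_of_integrable hd
    (((hJ.const_mul (t + 1)).sub (hI.const_mul t)).const_mul a) hf
  rw [integral_const_mul, integral_sub (hJ.const_mul _) (hI.const_mul _), integral_const_mul,
    integral_const_mul] at h0
  have := (mul_eq_zero.1 h0).resolve_left ha.ne'
  linarith

lemma aux_energy (p ω : ℝ) (hp : 1 < p) (hω : ω ∈ Set.Ioo (-1 : ℝ) 1) :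
    energyPhi p ω = ((p - 1 + 4 * ω ^ 2) / (p + 3)) * Nphi p ω := by
  obtain ⟨h1, h2⟩ := hω
  have hc2 : 0 < 1 - ω ^ 2 := by nlinarith
  have hcp := Real.sqrt_pos.2 hc2
  have hcsq := Real.sq_sqrt hc2.le
  have hp1 : 0 < p - 1 := by linarith
  obtain ⟨c, hc⟩ : ∃ c, c = Real.sqrt (1 - ω ^ 2) := ⟨_, rfl⟩
  rw [← hc] at hcp hcsq
  obtain ⟨a, ha⟩ : ∃ a, a = (p - 1) / 2 * c := ⟨_, rfl⟩
  have hap : 0 < a := by rw [ha]; positivity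
  obtain ⟨t, ht⟩ : ∃ t, t = 4 / (p - 1) := ⟨_, rfl⟩
  have htp : 0 < t := by rw [ht]; positivity
  obtain ⟨B, hB⟩ : ∃ B, B = (p + 1) * (1 - ω ^ 2) / 2 := ⟨_, rfl⟩
  have hBp : 0 < B := by rw [hB]; apply div_pos (mul_pos (by linarith) hc2) two_pos
  obtain ⟨A, hA⟩ : ∃ A, A = B ^ ((1 : ℝ) / (p - 1)) := ⟨_, rfl⟩
  have hAp : 0 < A := by rw [hA]; positivity
  have hAB : A ^ (p + 1) = A ^ 2 * B := by
    have : A ^ (p - 1) = B := by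
      rw [hA, ← Real.rpow_mul hBp.le, one_div_mul_cancel hp1.ne', Real.rpow_one]
    rw [← this, ← Real.rpow_natCast, ← Real.rpow_add hAp]; congr 1; push_cast; ring
  have hphi : groundState p ω = fun x => A * Real.cosh (a * x) ^ (-(t / 2)) := by
    funext x
    unfold groundState
    rw [← hc, ← ha, ← hB, ← hA, ht]
    congr 2
    field_simp
    norm_num
  have hI := aux_integrable a t hap htp
  have hJ := aux_integrable a (t + 2) hap (by linarith)
  have hIJ := aux_J a t hap htp
  have hN : Nphi p ω = A ^ 2 * ∫ x : ℝ, Real.cosh (a * x) ^ (-t) := by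
    unfold Nphi
    rw [hphi, ← integral_const_mul]
    congr 1
    funext x
    have hpos : 0 < Real.cosh (a * x) := Real.cosh_pos _
    rw [mul_pow, ← Real.rpow_mul_natCast hpos.le]
    congr 2; push_cast; ring
  have hK : Kphi p ω = c ^ 2 * A ^ 2 * ((∫ x : ℝ, Real.cosh (a * x) ^ (-t)) -
      ∫ x : ℝ, Real.cosh (a * x) ^ (-(t + 2))) := by
    unfold Kphi
    rw [hphi, ← integral_sub hI hJ, ← integral_const_mul]
    congr 1
    funext x
    have hpos : 0 < Real.cosh (a * x) := Real.cosh_pos _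
    rw [((aux_deriv a (-(t / 2)) x).const_mul A).deriv]
    have e2 : Real.cosh (a * x) ^ (-t) =
        Real.cosh (a * x) ^ (-(t + 2)) * Real.cosh (a * x) ^ 2 := by
      rw [← Real.rpow_natCast, ← Real.rpow_add hpos]; congr 1; push_cast; ring
    have e3 : (Real.cosh (a * x) ^ (-(t / 2) - 1)) ^ 2 = Real.cosh (a * x) ^ (-(t + 2)) := by
      rw [← Real.rpow_mul_natCast hpos.le]; congr 1; push_cast; ring
    have e4 : a * -(t / 2) = -c := by
      rw [ha, ht]; field_simp; norm_num
    rw [e4, e2, mul_pow, mul_pow, mul_pow, e3, Real.cosh_sq]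
    ring
  have hP : PPphi p ω = A ^ 2 * B * ∫ x : ℝ, Real.cosh (a * x) ^ (-(t + 2)) := by
    unfold PPphi
    rw [hphi, ← integral_const_mul]
    congr 1
    funext x
    have hpos : 0 < Real.cosh (a * x) := Real.cosh_pos _
    simp only []
    rw [Real.mul_rpow hAp.le (by positivity), hAB, ← Real.rpow_mul hpos.le]
    congr 2
    rw [ht]; field_simp; ring
  unfold energyPhi
  rw [hN, hK, hP, hcsq, hB]
  have hJ' : (∫ x : ℝ, Real.cosh (a * x) ^ (-(t + 2))) =
      4 / (p + 3) * ∫ x : ℝ, Real.cosh (a * x) ^ (-t) := by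
    have e : 4 / (p + 3) = t / (t + 1) := by
      have : p + 3 ≠ 0 := by linarith
      rw [ht]; field_simp; ring
    rw [e, div_mul_eq_mul_div, eq_div_iff (by linarith), ← hIJ]; ring
  rw [hJ']
  have : p + 3 ≠ 0 := by linarith
  have : p + 1 ≠ 0 := by linarith
  field_simp
  ring

theorem stmt4 (p ω : ℝ) (hp : 1 < p) (hω : ω ∈ Set.Ioo (-1 : ℝ) 1) :
    energyPhi p ω = ((p - 1 + 4 * ω ^ 2) / (p + 3)) * Nphi p ω ∧
    (p < 5 → |ω| = Real.sqrt (p - 1) / 2 →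
      (p + 3) * energyPhi p ω + 8 * ω * chargePhi p ω = 0) := by
  have hE := aux_energy p ω hp hω
  refine ⟨hE, fun _ hc => ?_⟩
  have hsq : ω ^ 2 = (p - 1) / 4 := by
    rw [← sq_abs, hc, div_pow, Real.sq_sqrt (by linarith)]; norm_num
  have hp3 : p + 3 ≠ 0 := by linarith
  have h2 : (p + 3) * energyPhi p ω = (p - 1 + 4 * ω ^ 2) * Nphi p ω := by
    rw [hE]; field_simp
  rw [h2]
  unfold chargePhi
  linear_combination (-4 * Nphi p ω) * hsq
end

section
/- Let 1 < p < 5 and ω_c = √(p−1)/2 ∈ (0,1). Define N(ω) = ∫_ℝ φ_ω(x)² dx for ω ∈ (−1,1), with φ_ω the explicit ground state. Then N is differentiable at ω_c, N(ω_c) > 0, and 2·ω_c·N'(ω_c) = −2·N(ω_c); in particular 2·ω_c·N'(ω_c) < 0. -/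
open MeasureTheory ComplexConjugate

theorem integrable_cosh_aux (q : ℝ) (hq : 0 < q) :
    Integrable (fun x : ℝ => Real.cosh x ^ (-q)) := by
  have hb : Integrable (fun x : ℝ => (2:ℝ) ^ q * Real.exp (-q * |x|)) := by
    apply Integrable.const_mul
    have h1 : IntegrableOn (fun x : ℝ => Real.exp (-q * |x|)) (Set.Ioi 0) := by
      refine (integrableOn_exp_mul_Ioi (a := -q) (by linarith) 0).congr_fun ?_ measurableSet_Ioi
      intro x hx
      simp only [abs_of_pos (Set.mem_Ioi.mp hx)]
    have h2 : IntegrableOn (fun x : ℝ => Real.exp (-q * |x|)) (Set.Iic 0) := by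
      refine (integrableOn_exp_mul_Iic (a := q) hq 0).congr_fun ?_ measurableSet_Iic
      intro x hx
      simp only [abs_of_nonpos (Set.mem_Iic.mp hx)]
      congr 1; ring
    rw [← integrableOn_univ, ← Set.Iic_union_Ioi (a := (0:ℝ))]
    exact h2.union h1
  refine hb.mono' ?_ (Filter.Eventually.of_forall fun x => ?_)
  · exact (Real.continuous_cosh.rpow_const
      (fun x => Or.inl (Real.cosh_pos x).ne')).aestronglyMeasurable
  · rw [Real.norm_of_nonneg (Real.rpow_nonneg (Real.cosh_pos x).le _)]
    have h : Real.exp |x| / 2 ≤ Real.cosh x := by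
      rw [← Real.cosh_abs, Real.cosh_eq]
      have := Real.exp_pos (-|x|)
      linarith
    calc Real.cosh x ^ (-q) ≤ (Real.exp |x| / 2) ^ (-q) :=
          Real.rpow_le_rpow_of_nonpos (by positivity) h (by linarith)
      _ = _ := by
          rw [Real.div_rpow (Real.exp_pos _).le (by norm_num), ← Real.exp_mul,
            Real.rpow_neg (by norm_num)]
          field_simp

theorem Nphi_formula (p ω : ℝ) (hp : 1 < p) (hω : 0 < 1 - ω ^ 2) :
    Nphi p ω = (((p + 1) / 2) ^ (2 / (p - 1)) * (2 / (p - 1)) *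
      ∫ x : ℝ, Real.cosh x ^ (-(4 / (p - 1)))) * (1 - ω ^ 2) ^ (2 / (p - 1) - 1 / 2) := by
  have hp' : 0 < p - 1 := by linarith
  have hs : 0 < Real.sqrt (1 - ω ^ 2) := Real.sqrt_pos.mpr hω
  have h : ∀ x : ℝ, groundState p ω x ^ 2 =
      ((p + 1) / 2) ^ (2 / (p - 1)) * (1 - ω ^ 2) ^ (2 / (p - 1)) *
        (fun y => Real.cosh y ^ (-(4 / (p - 1)))) ((p - 1) / 2 * Real.sqrt (1 - ω ^ 2) * x) := by
    intro x
    unfold groundState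
    have hc := Real.cosh_pos ((p - 1) / 2 * Real.sqrt (1 - ω ^ 2) * x)
    rw [mul_pow, ← Real.rpow_mul_natCast (by positivity), ← Real.rpow_mul_natCast hc.le,
      ← Real.mul_rpow (by positivity) hω.le]
    congr 2 <;> push_cast <;> ring
  unfold Nphi
  simp_rw [h]
  rw [integral_const_mul, Measure.integral_comp_mul_left
      (fun y : ℝ => Real.cosh y ^ (-(4 / (p - 1)))), abs_of_pos (by positivity),
    Real.rpow_sub hω, ← Real.sqrt_eq_rpow, smul_eq_mul]
  field_simp

theorem stmt7 (p : ℝ) (hp : 1 < p) (hp5 : p < 5) :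
    DifferentiableAt ℝ (Nphi p) (Real.sqrt (p - 1) / 2) ∧
    0 < Nphi p (Real.sqrt (p - 1) / 2) ∧
    2 * (Real.sqrt (p - 1) / 2) * deriv (Nphi p) (Real.sqrt (p - 1) / 2)
      = -2 * Nphi p (Real.sqrt (p - 1) / 2) ∧
    2 * (Real.sqrt (p - 1) / 2) * deriv (Nphi p) (Real.sqrt (p - 1) / 2) < 0 := by
  have hp' : 0 < p - 1 := by linarith
  have hp5' : 0 < 5 - p := by linarith
  set w : ℝ := Real.sqrt (p - 1) / 2 with hw
  have hw2 : w ^ 2 = (p - 1) / 4 := by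
    rw [hw, div_pow, Real.sq_sqrt hp'.le]; norm_num
  have hc : 1 - w ^ 2 = (5 - p) / 4 := by rw [hw2]; ring
  have hcpos : 0 < 1 - w ^ 2 := by rw [hc]; linarith
  have hKpos : 0 < ∫ x : ℝ, Real.cosh x ^ (-(4 / (p - 1))) := by
    rw [integral_pos_iff_support_of_nonneg
      (fun x => Real.rpow_nonneg (Real.cosh_pos x).le _) (integrable_cosh_aux _ (by positivity))]
    have : Function.support (fun x : ℝ => Real.cosh x ^ (-(4 / (p - 1)))) = Set.univ := by
      ext x
      simpa using (Real.rpow_pos_of_pos (Real.cosh_pos x) _).ne'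
    rw [this]; simp
  obtain ⟨C, hC⟩ : ∃ C, C = ((p + 1) / 2) ^ (2 / (p - 1)) * (2 / (p - 1)) *
      ∫ x : ℝ, Real.cosh x ^ (-(4 / (p - 1))) := ⟨_, rfl⟩
  have hCpos : 0 < C := by rw [hC]; positivity
  have hev : Nphi p =ᶠ[nhds w] fun ω => C * (1 - ω ^ 2) ^ (2 / (p - 1) - 1 / 2) := by
    have hcont : Continuous fun ω : ℝ => 1 - ω ^ 2 := by fun_prop
    filter_upwards [hcont.continuousAt.eventually (lt_mem_nhds hcpos)] with ω hω
    rw [hC]; exact Nphi_formula p ω hp hω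
  have hN : Nphi p w = C * (1 - w ^ 2) ^ (2 / (p - 1) - 1 / 2) := hev.eq_of_nhds
  have hNpos : 0 < Nphi p w := by rw [hN]; positivity
  have hbase : HasDerivAt (fun ω : ℝ => 1 - ω ^ 2) (-(2 * w)) w := by
    simpa using (hasDerivAt_pow 2 w).const_sub 1
  have hd := (((hbase.rpow_const (p := 2 / (p - 1) - 1 / 2)
    (Or.inl hcpos.ne')).const_mul C).congr_of_eventuallyEq hev)
  have hmain : 2 * w * deriv (Nphi p) w = -2 * Nphi p w := by
    rw [hd.deriv, hN, Real.rpow_sub_one hcpos.ne']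
    generalize (1 - w ^ 2) ^ (2 / (p - 1) - 1 / 2) = R
    have e : 2 * w * (C * (-(2 * w) * (2 / (p - 1) - 1 / 2) * (R / (1 - w ^ 2))))
      = -4 * w ^ 2 * (2 / (p - 1) - 1 / 2) / (1 - w ^ 2) * (C * R) := by ring
    rw [e, hc, hw2]
    field_simp
    ring
  exact ⟨hd.differentiableAt, hNpos, hmain, by rw [hmain]; linarith⟩
end
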